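/- Let u ∈ ℝ^{n+1} be a unit vector with all entries nonzero. For every x ∈ (0, π) and every real y with Φ_u(x, y) = 0, the complex number F_u(x + iy) is real, and F_u(x + iy) ≥ e^{x·cot x − 1}·(sin x)/x. (The right-hand side is the value along the analogous contour for the one-dimensional unit vector v = (1).) -/

import Mathlib

/-- The function `F_u(t) = ∏ j, e^{i u_j t} / (1 + i u_j t)`. -/
noncomputable def Fchar {m : ℕ} (u : Fin m → ℝ) (t : ℂ) : ℂ :=
  ∏ j, Complex.exp (Complex.I * u j * t) / (1 + Complex.I * u j * t)

/-- The continuous inverse cotangent with range `(0, π)`. -/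
noncomputable def arccot (θ : ℝ) : ℝ := Real.pi / 2 - Real.arctan θ

/-- The lifting `Φ_u(x, y)` of the argument of `F_u(x + iy)` (for `x > 0`). -/
noncomputable def Phi {m : ℕ} (u : Fin m → ℝ) (x y : ℝ) : ℝ :=
  x * ∑ j, u j
    - ∑ j ∈ Finset.univ.filter (fun j => 0 < u j), arccot ((1 / u j - y) / x)
    + ∑ j ∈ Finset.univ.filter (fun j => u j < 0), arccot (-(1 / u j - y) / x)

section

open Complex Filter Topology Set

/-- The height `1 - x cot x` of the contour of the one-dimensional vector `(1)`. -/
noncomputable def unitHeight (x : ℝ) : ℝ := 1 - Real.cos x / Real.sinc x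

/-- The logarithm `x cot x - 1 + log (sin x / x)` of the characteristic function of the
one-dimensional vector `(1)` along its contour. -/
noncomputable def unitLog (x : ℝ) : ℝ := Real.cos x / Real.sinc x - 1 + Real.log (Real.sinc x)

/-- The logarithm of `Fchar u`, as a sum of principal branches. -/
noncomputable def logFchar {m : ℕ} (u : Fin m → ℝ) (t : ℂ) : ℂ :=
  ∑ j, (I * u j * t - log (1 + I * u j * t))

lemma sinc_pos_of_mem_Ico {x : ℝ} (h0 : 0 ≤ x) (hpi : x < Real.pi) : 0 < Real.sinc x := by
  rcases h0.eq_or_lt with rfl | h0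
  · simp
  · rw [Real.sinc_of_ne_zero h0.ne']
    exact div_pos (Real.sin_pos_of_pos_of_lt_pi h0 hpi) h0

lemma mul_cos_le_sin {a : ℝ} (h0 : 0 < a) (hpi : a < Real.pi) : a * Real.cos a ≤ Real.sin a := by
  rcases lt_or_ge a (Real.pi / 2) with h | h
  · have hc := Real.cos_pos_of_mem_Ioo ⟨by linarith, h⟩
    have := Real.lt_tan h0 h
    rw [Real.tan_eq_sin_div_cos, lt_div_iff₀ hc] at this
    exact this.le
  · have hc := Real.cos_nonpos_of_pi_div_two_le_of_le h (by linarith)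
    have := Real.sin_pos_of_pos_of_lt_pi h0 hpi
    nlinarith

lemma monotoneOn_inv_sub_cot :
    MonotoneOn (fun a : ℝ => a⁻¹ - Real.cos a / Real.sin a) (Ioo 0 Real.pi) := by
  have hd : ∀ a ∈ Ioo 0 Real.pi, HasDerivAt (fun a : ℝ => a⁻¹ - Real.cos a / Real.sin a)
      (-(a ^ 2)⁻¹ - ((-Real.sin a) * Real.sin a - Real.cos a * Real.cos a) / Real.sin a ^ 2) a := by
    intro a ha
    exact (hasDerivAt_inv ha.1.ne').sub ((Real.hasDerivAt_cos a).div (Real.hasDerivAt_sin a)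
      (Real.sin_pos_of_pos_of_lt_pi ha.1 ha.2).ne')
  refine monotoneOn_of_deriv_nonneg (convex_Ioo _ _)
    (fun a ha => (hd a ha).continuousAt.continuousWithinAt)
    (fun a ha => (hd a (interior_subset ha)).differentiableAt.differentiableWithinAt) ?_
  intro a ha
  replace ha := interior_subset ha
  rw [(hd a ha).deriv]
  have hs := Real.sin_pos_of_pos_of_lt_pi ha.1 ha.2
  have h1 : (a ^ 2)⁻¹ ≤ (Real.sin a ^ 2)⁻¹ := by
    have := (Real.sin_lt ha.1).le
    gcongr
  have h2 : ((-Real.sin a) * Real.sin a - Real.cos a * Real.cos a) / Real.sin a ^ 2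
      = -(Real.sin a ^ 2)⁻¹ := by
    rw [← one_div, ← neg_div]
    congr 1
    linarith [Real.sin_sq_add_cos_sq a]
  rw [h2]
  linarith

lemma lt_arg_of_mul_sin_lt_mul_cos {z : ℂ} {a : ℝ} (hsign : 0 ≤ z.im ∧ a ≤ Real.pi ∨ a ≤ 0)
    (h : z.re * Real.sin a < z.im * Real.cos a) : a < arg z := by
  by_contra! hle
  have hge : -Real.pi ≤ arg z - a := by
    rcases hsign with ⟨h1, h2⟩ | h1
    · linarith [arg_nonneg_iff.2 h1]
    · linarith [neg_pi_lt_arg z]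
  have hs := Real.sin_nonpos_of_nonpos_of_neg_pi_le (by linarith : arg z - a ≤ 0) hge
  rw [Real.sin_sub] at hs
  have := mul_nonpos_of_nonneg_of_nonpos (norm_nonneg z) hs
  have e1 := norm_mul_cos_arg z
  have e2 := norm_mul_sin_arg z
  rw [← e1, ← e2] at h
  linarith

lemma lt_arg_one_add_I_mul {x y u : ℝ} (hx0 : 0 < x) (hxpi : x < Real.pi) (hu : u ≠ 0)
    (hu1 : |u| ≤ 1) (hy : unitHeight x < y) :
    u * x < arg (1 + I * u * (x + I * y)) := by
  have hre : (1 + I * u * (x + I * y)).re = 1 - u * y := by simp; ring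
  have him : (1 + I * u * (x + I * y)).im = u * x := by simp
  have hsx := Real.sin_pos_of_pos_of_lt_pi hx0 hxpi
  have hy' : (1 - y) * Real.sin x < x * Real.cos x := by
    rw [unitHeight, Real.sinc_of_ne_zero hx0.ne', div_div_eq_mul_div, sub_lt_comm,
      lt_div_iff₀ hsx] at hy
    linarith
  have hy0 : 0 < y := by nlinarith [mul_cos_le_sin hx0 hxpi]
  obtain ⟨hl, hr⟩ := abs_le.1 hu1
  rcases hu.lt_or_gt with hneg | hpos
  · have hb0 : 0 < -u * x := by nlinarith
    have hbpi : -u * x < Real.pi := by nlinarith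
    refine lt_arg_of_mul_sin_lt_mul_cos (.inr (by linarith)) ?_
    rw [hre, him]
    have hs := Real.sin_pos_of_pos_of_lt_pi hb0 hbpi
    have hc := mul_cos_le_sin hb0 hbpi
    rw [neg_mul, Real.sin_neg] at hs
    rw [neg_mul, Real.sin_neg, Real.cos_neg] at hc
    nlinarith [mul_pos (mul_pos (neg_pos.2 hneg) hy0) hs]
  · have hb0 : 0 < u * x := by positivity
    have hbx : u * x ≤ x := by nlinarith
    refine lt_arg_of_mul_sin_lt_mul_cos (.inl ⟨by rw [him]; exact hb0.le, by linarith⟩) ?_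
    rw [hre, him]
    have hs := Real.sin_pos_of_pos_of_lt_pi hb0 (hbx.trans_lt hxpi)
    have hm := monotoneOn_inv_sub_cot ⟨hb0, hbx.trans_lt hxpi⟩ ⟨hx0, hxpi⟩ hbx
    simp only at hm
    have h1 : x⁻¹ - Real.cos x / Real.sin x < y / x := by
      rw [inv_eq_one_div, div_sub_div _ _ hx0.ne' hsx.ne', div_lt_div_iff₀ (by positivity) hx0]
      nlinarith
    have h2 := hm.trans_lt h1
    rw [inv_eq_one_div, div_sub_div _ _ hb0.ne' hs.ne', div_lt_div_iff₀ (by positivity) hx0] at h2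
    have h3 : x * (1 * Real.sin (u * x) - u * x * Real.cos (u * x)) <
      x * (y * (u * Real.sin (u * x))) := by linarith
    have := lt_of_mul_lt_mul_left h3 hx0.le
    linarith

lemma hasDerivAt_unitLog {x : ℝ} (hx0 : 0 < x) (hxpi : x < Real.pi) :
    HasDerivAt unitLog (-((x ^ 2 + unitHeight x ^ 2) / x)) x := by
  have hsx := Real.sin_pos_of_pos_of_lt_pi hx0 hxpi
  have hd : HasDerivAt (fun x : ℝ => x * (Real.cos x / Real.sin x) - 1 +
      (Real.log (Real.sin x) - Real.log x))
      (1 * (Real.cos x / Real.sin x) + x * (((-Real.sin x) * Real.sin x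
        - Real.cos x * Real.cos x) / Real.sin x ^ 2) + (Real.cos x / Real.sin x - x⁻¹)) x :=
    (((hasDerivAt_id x).mul ((Real.hasDerivAt_cos x).div (Real.hasDerivAt_sin x) hsx.ne')).sub_const
      1).add (((Real.hasDerivAt_sin x).log hsx.ne').sub (Real.hasDerivAt_log hx0.ne'))
  refine (hd.congr_of_eventuallyEq ?_).congr_deriv ?_
  · filter_upwards [Ioo_mem_nhds hx0 hxpi] with z hz
    have hsz := Real.sin_pos_of_pos_of_lt_pi hz.1 hz.2
    rw [unitLog, Real.sinc_of_ne_zero hz.1.ne', Real.log_div hsz.ne' hz.1.ne',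
      div_div_eq_mul_div]
    ring
  · rw [unitHeight, Real.sinc_of_ne_zero hx0.ne']
    have := hsx.ne'
    field_simp
    ring

lemma one_add_I_mul_mem_slitPlane {t : ℂ} (ht : 0 < t.re) (u : ℝ) :
    1 + I * u * t ∈ slitPlane := by
  rcases eq_or_ne u 0 with rfl | hu
  · simp
  · refine mem_slitPlane_iff.2 (.inr ?_)
    simp [hu, ht.ne']

lemma exp_logFchar {m : ℕ} (u : Fin m → ℝ) {t : ℂ} (ht : 0 < t.re) :
    exp (logFchar u t) = Fchar u t := by
  rw [logFchar, Fchar, exp_sum]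
  refine Finset.prod_congr rfl fun j _ => ?_
  rw [exp_sub, exp_log (slitPlane_ne_zero (one_add_I_mul_mem_slitPlane ht _))]

lemma arccot_pos (c : ℝ) : 0 < arccot c := by
  have := Real.arctan_lt_pi_div_two c
  rw [arccot]
  linarith

lemma arccot_lt_pi (c : ℝ) : arccot c < Real.pi := by
  have := Real.neg_pi_div_two_lt_arctan c
  rw [arccot]
  linarith

lemma arg_mul_add_I {r : ℝ} (hr : 0 < r) (c : ℝ) : arg (r * (c + I)) = arccot c := by
  have hs : 0 < √(1 + c ^ 2) := by positivity
  have key : (r * (c + I) : ℂ) = (r * √(1 + c ^ 2) : ℝ) *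
      (cos (arccot c : ℝ) + sin (arccot c : ℝ) * I) := by
    rw [arccot, ← ofReal_cos, ← ofReal_sin, Real.cos_pi_div_two_sub, Real.sin_pi_div_two_sub,
      Real.sin_arctan, Real.cos_arctan]
    have : (√(1 + c ^ 2) : ℂ) ≠ 0 := by exact_mod_cast hs.ne'
    push_cast
    field_simp
  rw [key, arg_mul_cos_add_sin_mul_I (by positivity)
    ⟨by linarith [arccot_pos c, Real.pi_pos], (arccot_lt_pi c).le⟩]

lemma arg_mul_sub_I {r : ℝ} (hr : 0 < r) (c : ℝ) : arg (r * (c - I)) = -arccot c := by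
  have h := arg_conj ((r * (c + I) : ℂ))
  rw [arg_mul_add_I hr, if_neg (arccot_lt_pi c).ne] at h
  simpa [sub_eq_add_neg] using h

lemma im_logFchar {m : ℕ} {u : Fin m → ℝ} {x : ℝ} (y : ℝ) :
    (logFchar u (x + I * y)).im =
      ∑ j, (u j * x - arg (1 + I * u j * (x + I * y))) := by
  simp [logFchar, log_im]

lemma im_logFchar_eq_Phi {m : ℕ} {u : Fin m → ℝ} (hnz : ∀ j, u j ≠ 0) {x : ℝ} (hx : 0 < x)
    (y : ℝ) : (logFchar u (x + I * y)).im = Phi u x y := by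
  have hpos : ∀ j ∈ Finset.univ.filter (fun j => 0 < u j),
      arg (1 + I * u j * (x + I * y)) = arccot ((1 / u j - y) / x) := by
    intro j hj
    have hj := (Finset.mem_filter.1 hj).2
    rw [← arg_mul_add_I (mul_pos hj hx)]
    congr 1
    apply Complex.ext <;> simp
    field_simp
    ring
  have hneg : ∀ j ∈ Finset.univ.filter (fun j => u j < 0),
      arg (1 + I * u j * (x + I * y)) = -arccot (-(1 / u j - y) / x) := by
    intro j hj
    have hj := (Finset.mem_filter.1 hj).2
    rw [← arg_mul_sub_I (mul_pos (neg_pos.2 hj) hx)]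
    congr 1
    have := hj.ne
    apply Complex.ext <;> simp
    field_simp
    ring
  have hfilter : Finset.univ.filter (fun j => ¬ 0 < u j) =
      Finset.univ.filter (fun j => u j < 0) := by
    ext j
    simp [(hnz j).le_iff_lt]
  rw [im_logFchar, Finset.sum_sub_distrib, Phi,
    ← Finset.sum_filter_add_sum_filter_not _ (fun j => 0 < u j) (fun j => arg _), hfilter,
    Finset.sum_congr rfl hpos, Finset.sum_congr rfl hneg, ← Finset.sum_mul,
    Finset.sum_neg_distrib]
  ring

lemma abs_le_one_of_sum_sq_eq_one {m : ℕ} {u : Fin m → ℝ} (hu : ∑ j, u j ^ 2 = 1) (j : Fin m) :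
    |u j| ≤ 1 := by
  rw [← sq_le_one_iff_abs_le_one, ← hu]
  exact Finset.single_le_sum (f := fun j => u j ^ 2) (fun _ _ => sq_nonneg _) (Finset.mem_univ j)

lemma le_unitHeight_of_im_logFchar_eq_zero {m : ℕ} [NeZero m] {u : Fin m → ℝ}
    (hu : ∑ j, u j ^ 2 = 1) (hnz : ∀ j, u j ≠ 0) {x y : ℝ} (hx0 : 0 < x) (hxpi : x < Real.pi)
    (h : (logFchar u (x + I * y)).im = 0) : y ≤ unitHeight x := by
  by_contra! hy
  rw [im_logFchar] at h
  refine absurd h (ne_of_lt (Finset.sum_neg (fun j _ => ?_) Finset.univ_nonempty))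
  exact sub_neg.2 (lt_arg_one_add_I_mul hx0 hxpi (hnz j) (abs_le_one_of_sum_sq_eq_one hu j) hy)

lemma logFchar_neg_conj {m : ℕ} (u : Fin m → ℝ) {t : ℂ} (ht : 0 < t.re) :
    logFchar (-u) (starRingEnd ℂ t) = starRingEnd ℂ (logFchar u t) := by
  rw [logFchar, logFchar, map_sum]
  refine Finset.sum_congr rfl fun j _ => ?_
  rw [map_sub, ← log_conj _ (slitPlane_arg_ne_pi (one_add_I_mul_mem_slitPlane ht _))]
  simp

lemma abs_le_unitHeight_of_im_logFchar_eq_zero {m : ℕ} [NeZero m] {u : Fin m → ℝ}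
    (hu : ∑ j, u j ^ 2 = 1) (hnz : ∀ j, u j ≠ 0) {t : ℂ} (ht0 : 0 < t.re)
    (htpi : t.re < Real.pi) (h : (logFchar u t).im = 0) : |t.im| ≤ unitHeight t.re := by
  refine abs_le'.2 ⟨?_, ?_⟩
  · refine le_unitHeight_of_im_logFchar_eq_zero hu hnz ht0 htpi ?_
    rwa [mul_comm, re_add_im]
  · refine le_unitHeight_of_im_logFchar_eq_zero (u := -u) (by simpa using hu) (by simpa using hnz)
      ht0 htpi ?_
    have e : (t.re + I * (-t.im : ℝ) : ℂ) = starRingEnd ℂ t := by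
      apply Complex.ext <;> simp
    rw [e, logFchar_neg_conj u ht0, conj_im, h, neg_zero]

lemma hasStrictDerivAt_logFchar {m : ℕ} (u : Fin m → ℝ) {t : ℂ}
    (ht : ∀ j, 1 + I * u j * t ∈ slitPlane) :
    HasStrictDerivAt (logFchar u) (-∑ j, ((u j ^ 2 : ℝ) : ℂ) * (t / (1 + I * u j * t))) t := by
  rw [← Finset.sum_neg_distrib]
  refine HasStrictDerivAt.fun_sum fun j _ => ?_
  have h1 : HasStrictDerivAt (fun t : ℂ => I * u j * t) (I * u j) t := by
    simpa using (hasStrictDerivAt_id t).const_mul (I * u j : ℂ)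
  refine (h1.sub ((h1.const_add 1).clog (ht j))).congr_deriv ?_
  have := slitPlane_ne_zero (ht j)
  push_cast
  field_simp
  linear_combination (u j : ℂ) ^ 2 * t * I_sq

lemma sum_div_one_add_I_mul_mem_disc {m : ℕ} {u : Fin m → ℝ} (hu : ∑ j, u j ^ 2 = 1)
    {t : ℂ} (ht : 0 < t.re) :
    0 < (∑ j, ((u j ^ 2 : ℝ) : ℂ) * (t / (1 + I * u j * t))).re ∧
    t.re * normSq (∑ j, ((u j ^ 2 : ℝ) : ℂ) * (t / (1 + I * u j * t))) ≤
      normSq t * (∑ j, ((u j ^ 2 : ℝ) : ℂ) * (t / (1 + I * u j * t))).re := by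
  set w : Fin m → ℂ := fun j => t / (1 + I * u j * t) with hw
  have hden : ∀ j, 0 < normSq (1 + I * u j * t) := fun j =>
    normSq_pos.2 (slitPlane_ne_zero (one_add_I_mul_mem_slitPlane ht _))
  have hwre : ∀ j, (w j).re = t.re / normSq (1 + I * u j * t) := by
    intro j
    simp only [hw, div_re]
    rw [← add_div]
    congr 1
    simp
    ring
  have hwn : ∀ j, t.re * normSq (w j) = normSq t * (w j).re := by
    intro j
    rw [hwre]
    simp only [hw, normSq_div]
    ring
  have hre : (∑ j, ((u j ^ 2 : ℝ) : ℂ) * w j).re = ∑ j, u j ^ 2 * (w j).re := by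
    simp [re_sum, -ofReal_pow]
  have hpos : 0 < ∑ j, u j ^ 2 * (w j).re := by
    have hnn : ∀ j, 0 ≤ u j ^ 2 * (w j).re := fun j => by
      rw [hwre]
      have := hden j
      positivity
    refine (Finset.sum_nonneg fun j _ => hnn j).lt_of_ne' fun h0 => ?_
    rw [Finset.sum_eq_zero_iff_of_nonneg fun j _ => hnn j] at h0
    have : ∀ j, u j ^ 2 = 0 := fun j => by
      refine (mul_eq_zero.1 (h0 j (Finset.mem_univ j))).resolve_right ?_
      rw [hwre]
      exact (div_pos ht (hden j)).ne'
    simp [this] at hu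
  refine ⟨by rw [hre]; exact hpos, ?_⟩
  have hnorm : ‖∑ j, ((u j ^ 2 : ℝ) : ℂ) * w j‖ ≤ ∑ j, u j ^ 2 * ‖w j‖ := by
    refine (norm_sum_le _ _).trans_eq (Finset.sum_congr rfl fun j _ => ?_)
    rw [norm_mul, norm_real, Real.norm_of_nonneg (sq_nonneg _)]
  have hcs := Finset.sum_sq_le_sum_mul_sum_of_sq_le_mul Finset.univ
    (r := fun j => u j ^ 2 * ‖w j‖) (f := fun j => u j ^ 2) (g := fun j => u j ^ 2 * normSq (w j))
    (fun j _ => sq_nonneg _) (fun j _ => mul_nonneg (sq_nonneg _) (normSq_nonneg _))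
    (fun j _ => by rw [normSq_eq_norm_sq]; exact le_of_eq (by ring))
  rw [hu, one_mul] at hcs
  have h2 : normSq (∑ j, ((u j ^ 2 : ℝ) : ℂ) * w j) ≤ ∑ j, u j ^ 2 * normSq (w j) := by
    rw [normSq_eq_norm_sq]
    exact (pow_le_pow_left₀ (norm_nonneg _) hnorm 2).trans hcs
  calc t.re * normSq (∑ j, ((u j ^ 2 : ℝ) : ℂ) * w j)
      ≤ t.re * ∑ j, u j ^ 2 * normSq (w j) := by gcongr
    _ = normSq t * (∑ j, ((u j ^ 2 : ℝ) : ℂ) * w j).re := by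
        rw [hre, Finset.mul_sum, Finset.mul_sum]
        refine Finset.sum_congr rfl fun j _ => ?_
        linear_combination u j ^ 2 * hwn j

lemma eventually_lt_of_hasDerivAt_neg {f : ℝ → ℝ} {d r : ℝ} (hf : HasDerivAt f d r) (hd : d < 0) :
    ∀ᶠ z in 𝓝[>] r, f z < f r := by
  filter_upwards [hf.hasDerivWithinAt.limsup_slope_le' (s := Ioi r) self_notMem_Ioi hd,
    self_mem_nhdsWithin] with z hz hrz
  rw [slope_def_field, div_lt_iff₀ (sub_pos.2 hrz), zero_mul] at hz
  linarith

/-- Along the contour of `u`, the excess of `logFchar u` over `unitLog`, tilted by a small linear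
term, can always be decreased by moving towards the origin. -/
lemma exists_excess_lt {m : ℕ} [NeZero m] {u : Fin m → ℝ}
    (hu : ∑ j, u j ^ 2 = 1) (hnz : ∀ j, u j ≠ 0) {t : ℂ} (ht0 : 0 < t.re)
    (htpi : t.re < Real.pi) (h : (logFchar u t).im = 0) {ε : ℝ} (hε : 0 < ε) :
    ∃ s : ℂ, 0 < s.re ∧ s.re < t.re ∧ (logFchar u s).im = 0 ∧
      (logFchar u s).re - unitLog s.re + ε * s.re <
        (logFchar u t).re - unitLog t.re + ε * t.re := by
  have hL := hasStrictDerivAt_logFchar u (one_add_I_mul_mem_slitPlane ht0 <| u ·)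
  obtain ⟨hW, hdisc⟩ := sum_div_one_add_I_mul_mem_disc hu ht0
  set W := ∑ j, ((u j ^ 2 : ℝ) : ℂ) * (t / (1 + I * u j * t))
  have hW0 : W ≠ 0 := by
    rintro h0
    simp [h0] at hW
  set r := (logFchar u t).re
  have hr : logFchar u t = (r : ℂ) := Complex.ext rfl (by simpa using h)
  set g := hL.localInverse _ _ _ (neg_ne_zero.2 hW0)
  have hgr : g r = t := by
    rw [← hr]
    exact (hL.eventually_left_inverse (neg_ne_zero.2 hW0)).self_of_nhds
  have hX : HasDerivAt (fun ρ : ℝ => (g ρ).re) (-W)⁻¹.re r := by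
    refine HasDerivAt.real_of_complex ?_
    rw [← hr]
    exact (hL.to_localInverse (neg_ne_zero.2 hW0)).hasDerivAt
  have hN : 0 < normSq W := normSq_pos.2 hW0
  have hX' : (-W)⁻¹.re = -(W.re / normSq W) := by simp [inv_re]
  have hXneg : (-W)⁻¹.re < 0 := by
    rw [hX', neg_lt_zero]
    exact div_pos hW hN
  have hU : HasDerivAt unitLog (-((t.re ^ 2 + unitHeight t.re ^ 2) / t.re)) (g r).re := by
    rw [hgr]
    exact hasDerivAt_unitLog ht0 htpi
  have hf : HasDerivAt (fun ρ : ℝ => ρ - unitLog (g ρ).re + ε * (g ρ).re)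
      (1 - -((t.re ^ 2 + unitHeight t.re ^ 2) / t.re) * (-W)⁻¹.re + ε * (-W)⁻¹.re) r :=
    ((hasDerivAt_id r).sub (HasDerivAt.comp (h := fun ρ : ℝ => (g ρ).re) r hU hX)).add (hX.const_mul ε)
  have hfneg : 1 - -((t.re ^ 2 + unitHeight t.re ^ 2) / t.re) * (-W)⁻¹.re + ε * (-W)⁻¹.re < 0 := by
    have himle : normSq t ≤ t.re ^ 2 + unitHeight t.re ^ 2 := by
      rw [normSq_apply, ← sq, ← sq, add_le_add_iff_left]
      exact sq_le_sq' (neg_le_of_abs_le (abs_le_unitHeight_of_im_logFchar_eq_zero hu hnz ht0 htpi h))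
        (le_of_abs_le (abs_le_unitHeight_of_im_logFchar_eq_zero hu hnz ht0 htpi h))
    have h1 : 1 ≤ (t.re ^ 2 + unitHeight t.re ^ 2) / t.re * (W.re / normSq W) := by
      rw [div_mul_div_comm, one_le_div (by positivity)]
      exact hdisc.trans (by gcongr)
    have := mul_neg_of_pos_of_neg hε hXneg
    rw [hX'] at this ⊢
    linarith
  have hright : ∀ᶠ ρ : ℝ in 𝓝 r, logFchar u (g ρ) = ρ := by
    have := hL.eventually_right_inverse (neg_ne_zero.2 hW0)
    rw [hr] at this
    exact continuous_ofReal.continuousAt.eventually this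
  have hXpos : ∀ᶠ ρ : ℝ in 𝓝 r, 0 < (g ρ).re :=
    hX.continuousAt.eventually_const_lt (by simpa only [hgr] using ht0)
  obtain ⟨ρ, h1, h2, h3, h4⟩ := ((eventually_lt_of_hasDerivAt_neg hX hXneg).and
    ((eventually_lt_of_hasDerivAt_neg hf hfneg).and
      ((hright.filter_mono nhdsWithin_le_nhds).and
        (hXpos.filter_mono nhdsWithin_le_nhds)))).exists
  rw [hgr] at h1 h2
  exact ⟨g ρ, h4, h1, by simp [h3], by simpa [h3] using h2⟩

lemma continuousOn_cos_div_sinc {x : ℝ} (hx : x < Real.pi) :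
    ContinuousOn (fun a => Real.cos a / Real.sinc a) (Icc 0 x) :=
  Real.continuous_cos.continuousOn.div Real.continuous_sinc.continuousOn
    fun _ ha => (sinc_pos_of_mem_Ico ha.1 (ha.2.trans_lt hx)).ne'

lemma continuousOn_unitLog {x : ℝ} (hx : x < Real.pi) : ContinuousOn unitLog (Icc 0 x) :=
  ((continuousOn_cos_div_sinc hx).sub continuousOn_const).add
    (Real.continuous_sinc.continuousOn.log
      fun _ ha => (sinc_pos_of_mem_Ico ha.1 (ha.2.trans_lt hx)).ne')

lemma unitLog_le_re_logFchar {m : ℕ} [NeZero m] {u : Fin m → ℝ}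
    (hu : ∑ j, u j ^ 2 = 1) (hnz : ∀ j, u j ≠ 0) {t : ℂ} (ht0 : 0 < t.re)
    (htpi : t.re < Real.pi) (h : (logFchar u t).im = 0) :
    unitLog t.re ≤ (logFchar u t).re := by
  let K : Set ℂ := (fun p : ℝ × ℝ => (p.1 + I * (p.2 * unitHeight p.1) : ℂ)) ''
    (Icc 0 t.re ×ˢ Icc (-1) 1)
  have hKc : IsCompact K := by
    refine (isCompact_Icc.prod isCompact_Icc).image_of_continuousOn ?_
    have : ContinuousOn (fun p : ℝ × ℝ => unitHeight p.1) (Icc 0 t.re ×ˢ Icc (-1) 1) :=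
      (continuousOn_const.sub (continuousOn_cos_div_sinc htpi)).comp continuousOn_fst
        fun p hp => hp.1
    have := continuous_ofReal.comp_continuousOn this
    simp only [Function.comp_def] at this
    fun_prop
  have hK : ∀ s ∈ K, s.re ∈ Icc 0 t.re ∧ (s = 0 ∨ 0 < s.re) := by
    rintro _ ⟨⟨a, b⟩, ⟨ha, hb⟩, rfl⟩
    simp only at ha hb ⊢
    have hre : (a + I * (b * unitHeight a) : ℂ).re = a := by simp
    refine ⟨by rwa [hre], ?_⟩
    rw [hre]
    rcases ha.1.eq_or_lt with rfl | ha
    · left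
      simp [unitHeight]
    · exact .inr ha
  have hmem : ∀ s : ℂ, 0 < s.re → s.re ≤ t.re → (logFchar u s).im = 0 → s ∈ K := by
    intro s hs0 hst hs
    have hle := abs_le_unitHeight_of_im_logFchar_eq_zero hu hnz hs0 (hst.trans_lt htpi) hs
    refine ⟨(s.re, s.im / unitHeight s.re), ⟨⟨hs0.le, hst⟩, ?_⟩, ?_⟩
    · refine abs_le.1 ?_
      rw [abs_div, abs_of_nonneg ((abs_nonneg _).trans hle)]
      exact div_le_one_of_le₀ hle ((abs_nonneg _).trans hle)
    · have : s.im / unitHeight s.re * unitHeight s.re = s.im :=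
        div_mul_cancel_of_imp fun h0 => abs_nonpos_iff.1 (hle.trans_eq h0)
      simp only
      rw [← ofReal_mul, this, mul_comm, re_add_im]
  have hLc : ContinuousOn (logFchar u) K := fun s hs => by
    refine ((hasStrictDerivAt_logFchar u fun j => ?_).hasDerivAt.continuousAt).continuousWithinAt
    rcases (hK s hs).2 with rfl | hpos
    · simp
    · exact one_add_I_mul_mem_slitPlane hpos _
  let Z : Set ℂ := K ∩ (fun s => (logFchar u s).im) ⁻¹' {0}
  have hZc : IsCompact Z := hKc.of_isClosed_subset
    ((continuous_im.comp_continuousOn hLc).preimage_isClosed_of_isClosed hKc.isClosed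
      isClosed_singleton) inter_subset_left
  have htZ : t ∈ Z := ⟨hmem t ht0 le_rfl h, h⟩
  refine le_of_forall_pos_le_add fun δ hδ => ?_
  have hε : 0 < δ / t.re := div_pos hδ ht0
  have hcont : ContinuousOn
      (fun s : ℂ => (logFchar u s).re - unitLog s.re + δ / t.re * s.re) Z :=
    ((continuous_re.comp_continuousOn (hLc.mono inter_subset_left)).sub
      ((continuousOn_unitLog htpi).comp continuous_re.continuousOn
        fun s hs => (hK s hs.1).1)).add (continuous_const.mul continuous_re).continuousOn
  obtain ⟨s, hsZ, hmin⟩ := hZc.exists_isMinOn ⟨t, htZ⟩ hcont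
  have hs0 : s = 0 := by
    refine (hK s hsZ.1).2.resolve_right fun hpos => ?_
    have hst := (hK s hsZ.1).1.2
    obtain ⟨s', h0, hlt, him, hdec⟩ :=
      exists_excess_lt hu hnz hpos (hst.trans_lt htpi) hsZ.2 hε
    exact (hmin ⟨hmem s' h0 (hlt.le.trans hst) him, him⟩).not_gt hdec
  have hfin := hmin htZ
  have hL0 : logFchar u 0 = 0 := by simp [logFchar]
  have hU0 : unitLog 0 = 0 := by simp [unitLog]
  simp only [hs0, mem_ofPred_eq, hL0, zero_re, hU0, mul_zero, sub_zero, add_zero,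
    div_mul_cancel₀ _ ht0.ne'] at hfin
  linarith

lemma exp_unitLog {x : ℝ} (hx0 : 0 < x) (hxpi : x < Real.pi) :
    Real.exp (unitLog x) = Real.exp (x * Real.cot x - 1) * Real.sin x / x := by
  rw [unitLog, Real.exp_add, Real.exp_log (sinc_pos_of_mem_Ico hx0.le hxpi),
    Real.sinc_of_ne_zero hx0.ne', Real.cot_eq_cos_div_sin, div_div_eq_mul_div, mul_div_assoc',
    mul_div_assoc', mul_comm x]

end

theorem stmt13 (n : ℕ) (u : Fin (n + 1) → ℝ) (hu : ∑ j, (u j) ^ 2 = 1)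
    (hnz : ∀ j, u j ≠ 0) (x : ℝ) (hx : x ∈ Set.Ioo 0 Real.pi)
    (y : ℝ) (hy : Phi u x y = 0) :
    (Fchar u (x + Complex.I * y)).im = 0 ∧
    (Fchar u (x + Complex.I * y)).re ≥
      Real.exp (x * Real.cot x - 1) * Real.sin x / x := by
  have him : (logFchar u (x + Complex.I * y)).im = 0 := by rw [im_logFchar_eq_Phi hnz hx.1, hy]
  have hre : (x + Complex.I * y : ℂ).re = x := by simp
  have hpos : 0 < (x + Complex.I * y : ℂ).re := by rw [hre]; exact hx.1
  have hlt : (x + Complex.I * y : ℂ).re < Real.pi := by rw [hre]; exact hx.2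
  have hle := unitLog_le_re_logFchar hu hnz hpos hlt him
  rw [hre] at hle
  have hF : Fchar u (x + Complex.I * y) =
      (Real.exp (logFchar u (x + Complex.I * y)).re : ℂ) := by
    rw [← exp_logFchar u hpos, Complex.ofReal_exp]
    congr 1
    exact Complex.ext rfl (by simpa using him)
  rw [hF, Complex.ofReal_im, Complex.ofReal_re, ← exp_unitLog hx.1 hx.2]
  exact ⟨rfl, Real.exp_le_exp.2 hle⟩
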